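/- Let k be a field, S = k[x₀,…,x_n] the polynomial ring in n+1 variables with n ≥ 1, q ≥ 1 an integer, and f ∈ S a homogeneous polynomial of degree d with 0 < d ≤ (n+1)(q−1). Set I = (x₀^q,…,x_n^q), let c_i = dim_k of the degree-i component of S/I (with c_i = 0 for i < 0), let m(q) = ⌊((n+1)(q−1) + d − 1)/2⌋, and let L(q) = Σ_i max{c_i − c_{i−d}, 0}. Then the socle degree of S/(I + (f)) equals m(q) if and only if dim_k S/(I + (f)) = L(q). -/

import Mathlib

open MvPolynomial

/-- The dimension of the degree-`j` homogeneous component of `S/J`, where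
`S = k[x₀,…,x_{N−1}]`: the `k`-dimension of the image in `S/J` of the space of
homogeneous polynomials of degree `j` (zero for negative `j`). -/
noncomputable def quotComponentDim (k : Type*) [Field k] (N : ℕ)
    (J : Ideal (MvPolynomial (Fin N) k)) (j : ℤ) : ℕ :=
  if 0 ≤ j then
    Module.finrank k ((homogeneousSubmodule (Fin N) k j.toNat).map
      (Ideal.Quotient.mkₐ k J).toLinearMap)
  else 0

/-- The number of monomials of degree `i` in `N` variables with all exponents less than `q`,
defined by recursion on `N`. -/
def boxCount (q : ℕ) : ℕ → ℤ → ℕ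
  | 0, i => if i = 0 then 1 else 0
  | N + 1, i => ∑ j ∈ Finset.range q, boxCount q N (i - j)

lemma boxCount_of_neg (q N : ℕ) {i : ℤ} (hi : i < 0) : boxCount q N i = 0 := by
  induction N generalizing i with
  | zero => simp [boxCount, hi.ne]
  | succ N ih => exact Finset.sum_eq_zero fun j _ => ih (by omega)

lemma boxCount_symm (q N : ℕ) (i : ℤ) :
    boxCount q N (N * (q - 1) - i) = boxCount q N i := by
  induction N generalizing i with
  | zero => simp [boxCount]
  | succ N ih =>
    simp only [boxCount]
    rw [← Finset.sum_range_reflect]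
    refine Finset.sum_congr rfl fun j hj => ?_
    have hj' := Finset.mem_range.1 hj
    rw [← ih (i - j)]
    congr 1
    push_cast [show j ≤ q - 1 by omega, Nat.sub_sub, show 1 + j ≤ q by omega]
    ring

lemma boxCount_succ_sub (q N : ℕ) (i : ℤ) :
    (boxCount q (N + 1) i : ℤ) - boxCount q (N + 1) (i - 1) =
      boxCount q N i - boxCount q N (i - q) := by
  simp only [boxCount]
  push_cast
  rw [← Finset.sum_sub_distrib]
  have := Finset.sum_range_sub' (fun j : ℕ => (boxCount q N (i - j) : ℤ)) q
  simp only [Nat.cast_zero, sub_zero] at this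
  rw [← this]
  refine Finset.sum_congr rfl fun j _ => ?_
  congr 3
  push_cast
  ring

lemma boxCount_le_of_step (q N : ℕ)
    (step : ∀ i : ℤ, 2 * i ≤ N * (q - 1) + 1 → boxCount q N (i - 1) ≤ boxCount q N i)
    {a b : ℤ} (hab : a ≤ b) (h : a + b ≤ N * (q - 1)) : boxCount q N a ≤ boxCount q N b := by
  have chain : ∀ (t : ℕ) (b : ℤ), 2 * b ≤ N * (q - 1) + 1 →
      boxCount q N (b - t) ≤ boxCount q N b := by
    intro t
    induction t with
    | zero => simp
    | succ t ih =>
      intro b hb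
      refine le_trans ?_ (ih b hb)
      rw [Nat.cast_add_one, ← sub_sub]
      exact step (b - t) (by omega)
  have low : ∀ {a b : ℤ}, a ≤ b → 2 * b ≤ N * (q - 1) + 1 →
      boxCount q N a ≤ boxCount q N b := by
    intro a b hab hb
    have := chain (b - a).toNat b hb
    rwa [Int.toNat_of_nonneg (by omega), sub_sub_cancel] at this
  by_cases hb : 2 * b ≤ N * (q - 1) + 1
  · exact low hab hb
  · rw [← boxCount_symm q N b]
    exact low (by omega) (by omega)

lemma boxCount_step (q N : ℕ) (i : ℤ) (hi : 2 * i ≤ N * (q - 1) + 1) :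
    boxCount q N (i - 1) ≤ boxCount q N i := by
  induction N generalizing i with
  | zero =>
    rw [boxCount_of_neg _ _ (by push_cast at hi; omega)]
    exact Nat.zero_le _
  | succ N ih =>
    have h₁ := boxCount_succ_sub q N i
    have h₂ : boxCount q N (i - q) ≤ boxCount q N i :=
      boxCount_le_of_step q N ih (by omega) (by push_cast at hi; linarith)
    omega

lemma boxCount_le (q N : ℕ) {a b : ℤ} (hab : a ≤ b)
    (h : a + b ≤ N * (q - 1)) : boxCount q N a ≤ boxCount q N b :=
  boxCount_le_of_step q N (boxCount_step q N) hab h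

lemma boxCount_lt_of_step (q N : ℕ)
    (step : ∀ i : ℤ, 0 ≤ i → 2 * i ≤ N * (q - 1) → boxCount q N (i - 1) < boxCount q N i)
    {a b : ℤ} (hab : a < b) (h : a + b < N * (q - 1)) (h0 : 0 ≤ b) (hb : b ≤ N * (q - 1)) :
    boxCount q N a < boxCount q N b := by
  by_cases hb' : 2 * b ≤ N * (q - 1)
  · exact (boxCount_le q N (by omega) (by omega)).trans_lt (step b h0 hb')
  · rw [← boxCount_symm q N b]
    exact (boxCount_le q N (by omega) (by omega)).trans_lt (step _ (by omega) (by omega))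

lemma boxCount_one (q : ℕ) {i : ℤ} (h0 : 0 ≤ i) (hi : i < q) : boxCount q 1 i = 1 := by
  simp only [boxCount]
  rw [Finset.sum_eq_single_of_mem i.toNat (Finset.mem_range.2 (by omega))]
  · rw [if_pos (by omega)]
  · intro j _ hj
    rw [if_neg (by omega)]

lemma boxCount_lt {q : ℕ} (hq : 2 ≤ q) (N : ℕ) (hN : 2 ≤ N) {a b : ℤ} (hab : a < b)
    (h : a + b < N * (q - 1)) (h0 : 0 ≤ b) (hb : b ≤ N * (q - 1)) :
    boxCount q N a < boxCount q N b := by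
  induction N, hN using Nat.le_induction generalizing a b with
  | base =>
    refine boxCount_lt_of_step q 2 (fun i hi hi' => ?_) hab h h0 hb
    have h₁ := boxCount_succ_sub q 1 i
    rw [boxCount_one q hi (by push_cast at hi'; omega),
      boxCount_of_neg q 1 (by push_cast at hi'; omega)] at h₁
    norm_num at h₁
    omega
  | succ N hN ih =>
    refine boxCount_lt_of_step q (N + 1) (fun i hi hi' => ?_) hab h h0 hb
    have h₁ := boxCount_succ_sub q N i
    have h₂ : (q : ℤ) - 1 ≤ N * (q - 1) := by
      have : (1 : ℤ) ≤ N := by omega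
      have : (0 : ℤ) ≤ q - 1 := by omega
      nlinarith
    have h₃ : ((N + 1 : ℕ) : ℤ) * (q - 1) = N * (q - 1) + (q - 1) := by push_cast; ring
    rw [h₃] at hi'
    have := @ih (i - q) i (by omega) (by omega) hi (by omega)
    omega

lemma card_filter_sum_eq_boxCount (q N : ℕ) (i : ℤ) :
    (Finset.univ.filter fun e : Fin N → Fin q => ((∑ j, (e j : ℕ) : ℕ) : ℤ) = i).card =
      boxCount q N i := by
  rw [Finset.card_filter]
  induction N generalizing i with
  | zero => simp [boxCount, eq_comm]
  | succ N ih =>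
    rw [← (Fin.consEquiv fun _ : Fin (N + 1) => Fin q).sum_comp, Fintype.sum_prod_type]
    simp only [boxCount]
    rw [Finset.sum_range]
    refine Finset.sum_congr rfl fun x _ => ?_
    rw [← ih]
    refine Finset.sum_congr rfl fun e _ => ?_
    simp only [Fin.consEquiv_apply, Fin.sum_univ_succ, Fin.cons_zero, Fin.cons_succ]
    congr 1
    simp only [eq_iff_iff]
    push_cast
    constructor <;> intro h <;> linarith

section
variable {k : Type*} [Field k] {N : ℕ}

/-- The ideal generated by the `q`-th powers of the variables. -/
noncomputable def powIdeal (k : Type*) [Field k] (N q : ℕ) : Ideal (MvPolynomial (Fin N) k) :=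
  Ideal.span (Set.range fun i : Fin N => X i ^ q)

lemma mem_powIdeal {q : ℕ} {p : MvPolynomial (Fin N) k} :
    p ∈ powIdeal k N q ↔ ∀ e ∈ p.support, ∃ i, q ≤ e i := by
  have : (Set.range fun i : Fin N => (X i ^ q : MvPolynomial (Fin N) k)) =
      (fun s => monomial s 1) '' Set.range fun i : Fin N => Finsupp.single i q := by
    rw [← Set.range_comp]
    simp [Function.comp_def, X_pow_eq_monomial]
  rw [powIdeal, this, mem_ideal_span_monomial_image]
  simp

lemma isHomogeneous_mem_powIdeal {q i : ℕ} (hi : N * (q - 1) < i)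
    {p : MvPolynomial (Fin N) k} (hp : p.IsHomogeneous i) : p ∈ powIdeal k N q := by
  rw [mem_powIdeal]
  intro e he
  by_contra! h
  have hdeg : e.degree = i := by
    by_contra hne
    exact mem_support_iff.1 he (hp.coeff_eq_zero hne)
  have : e.degree ≤ N * (q - 1) := by
    rw [Finsupp.degree_eq_sum]
    calc ∑ j, e j ≤ ∑ _j : Fin N, (q - 1) := Finset.sum_le_sum fun j _ => by
          have := h j; omega
      _ = N * (q - 1) := by simp
  omega

/-- The image in `S/J` of the space of homogeneous polynomials of degree `i`. -/
noncomputable def quotComponent (J : Ideal (MvPolynomial (Fin N) k)) (i : ℕ) :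
    Submodule k (MvPolynomial (Fin N) k ⧸ J) :=
  (homogeneousSubmodule (Fin N) k i).map (Ideal.Quotient.mkₐ k J).toLinearMap

instance (i : ℕ) : FiniteDimensional k (homogeneousSubmodule (Fin N) k i) :=
  Module.Finite.iff_fg.2 (homogeneousSubmodule_fg (Fin N) k i)

instance (J : Ideal (MvPolynomial (Fin N) k)) (i : ℕ) :
    FiniteDimensional k (quotComponent J i) := by
  unfold quotComponent; infer_instance

lemma quotComponentDim_natCast (J : Ideal (MvPolynomial (Fin N) k)) (i : ℕ) :
    quotComponentDim k N J i = Module.finrank k (quotComponent J i) := by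
  rw [quotComponentDim, if_pos (Int.natCast_nonneg i), Int.toNat_natCast]
  rfl

lemma finrank_quotComponent_powIdeal (q i : ℕ) :
    Module.finrank k (quotComponent (powIdeal k N q) i) = boxCount q N i := by
  classical
  let E := {e : Fin N → Fin q // ((∑ j, (e j : ℕ) : ℕ) : ℤ) = i}
  let ex : E → (Fin N →₀ ℕ) := fun e => Finsupp.equivFunOnFinite.symm fun j => (e.1 j : ℕ)
  have ex_inj : Function.Injective ex := by
    intro a b hab
    ext j
    exact DFunLike.congr_fun hab j
  let b : E → MvPolynomial (Fin N) k ⧸ powIdeal k N q :=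
    fun e => (Ideal.Quotient.mkₐ k (powIdeal k N q)).toLinearMap (monomial (ex e) 1)
  have hb : LinearIndependent k b := by
    rw [Fintype.linearIndependent_iff]
    intro g hg e
    have h₁ : ∑ e, monomial (ex e) (g e) ∈ powIdeal k N q := by
      rw [← Ideal.Quotient.eq_zero_iff_mem, ← hg, map_sum]
      refine Finset.sum_congr rfl fun e _ => ?_
      rw [← mul_one (g e), ← smul_eq_mul, ← smul_monomial, smul_eq_mul, mul_one]
      rfl
    have h₂ : coeff (ex e) (∑ e, monomial (ex e) (g e)) = g e := by
      rw [coeff_sum, Finset.sum_eq_single e, coeff_monomial, if_pos rfl]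
      · intro e' _ he'
        rw [coeff_monomial, if_neg (ex_inj.ne he')]
      · exact fun h => absurd (Finset.mem_univ e) h
    by_contra hne
    obtain ⟨j, hj⟩ := mem_powIdeal.1 h₁ (ex e) (by rw [mem_support_iff, h₂]; exact hne)
    exact absurd hj (not_le.2 (e.1 j).2)
  have hspan : Submodule.span k (Set.range b) = quotComponent (powIdeal k N q) i := by
    apply le_antisymm
    · rw [Submodule.span_le]
      rintro _ ⟨e, rfl⟩
      refine Submodule.mem_map_of_mem (isHomogeneous_monomial _ ?_)
      rw [Finsupp.degree_eq_sum]
      exact_mod_cast e.2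
    · rintro _ ⟨p, hp, rfl⟩
      rw [p.as_sum, map_sum]
      refine Submodule.sum_mem _ fun e he => ?_
      by_cases h : ∃ j, q ≤ e j
      · have : monomial e (coeff e p) ∈ powIdeal k N q := by
          rw [mem_powIdeal]
          intro e' he'
          rw [Finset.mem_singleton.1 (support_monomial_subset he')]
          exact h
        convert Submodule.zero_mem _
        exact Ideal.Quotient.eq_zero_iff_mem.2 this
      · push Not at h
        have hdeg : e.degree = i := by
          by_contra hne
          exact mem_support_iff.1 he (hp.coeff_eq_zero hne)
        rw [← mul_one (coeff e p), ← smul_eq_mul, ← smul_monomial, map_smul]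
        refine Submodule.smul_mem _ _ (Submodule.subset_span ⟨⟨fun j => ⟨e j, h j⟩, ?_⟩, ?_⟩)
        · rw [← hdeg, Finsupp.degree_eq_sum]
        · simp only [b]
          congr 2
          congr 1
          ext j
          rfl
  rw [← hspan, finrank_span_eq_card hb, Fintype.card_subtype, card_filter_sum_eq_boxCount]

lemma quotComponentDim_powIdeal (q : ℕ) (i : ℤ) :
    quotComponentDim k N (powIdeal k N q) i = boxCount q N i := by
  by_cases hi : 0 ≤ i
  · lift i to ℕ using hi
    rw [quotComponentDim_natCast, finrank_quotComponent_powIdeal]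
  · rw [quotComponentDim, if_neg hi, boxCount_of_neg _ _ (not_le.1 hi)]

attribute [local instance] MvPolynomial.gradedAlgebra

lemma homogeneousComponent_mem_powIdeal_sup {q d : ℕ} {f : MvPolynomial (Fin N) k}
    (hf : f.IsHomogeneous d) {p : MvPolynomial (Fin N) k}
    (hp : p ∈ powIdeal k N q + Ideal.span {f}) (i : ℕ) :
    homogeneousComponent i p ∈ powIdeal k N q + Ideal.span {f} := by
  have : (powIdeal k N q + Ideal.span {f}).IsHomogeneous (homogeneousSubmodule (Fin N) k) := by
    rw [powIdeal, Submodule.add_eq_sup, ← Ideal.span_union]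
    refine Ideal.homogeneous_span _ _ ?_
    rintro x (⟨j, rfl⟩ | rfl)
    · exact ⟨q, isHomogeneous_X_pow j q⟩
    · exact ⟨d, hf⟩
  exact homogeneousComponent_mem_of_mem this hp i

lemma homogeneousComponent_mem_powIdeal {q : ℕ} {p : MvPolynomial (Fin N) k}
    (hp : p ∈ powIdeal k N q) (i : ℕ) : homogeneousComponent i p ∈ powIdeal k N q := by
  rw [mem_powIdeal] at hp ⊢
  intro e he
  rw [support_homogeneousComponent] at he
  exact hp e (Finset.mem_filter.1 he).1

lemma homogeneousComponent_mul_of_isHomogeneous {d : ℕ} {f : MvPolynomial (Fin N) k}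
    (hf : f.IsHomogeneous d) (p : MvPolynomial (Fin N) k) (i : ℕ) :
    homogeneousComponent i (p * f) =
      if d ≤ i then homogeneousComponent (i - d) p * f else 0 := by
  have := DirectSum.coe_decompose_mul_of_right_mem (homogeneousSubmodule (Fin N) k) (a := p) i
    (hf : f ∈ homogeneousSubmodule (Fin N) k d)
  have key (p : MvPolynomial (Fin N) k) (i : ℕ) :
      (DirectSum.decompose (homogeneousSubmodule (Fin N) k) p i : MvPolynomial (Fin N) k) =
        homogeneousComponent i p := decomposition.decompose'_apply p i
  rwa [key, key] at this

lemma isHomogeneous_mem_powIdeal_sup_iff {q d i : ℕ} {f : MvPolynomial (Fin N) k}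
    (hf : f.IsHomogeneous d) {p : MvPolynomial (Fin N) k} (hp : p.IsHomogeneous i) :
    p ∈ powIdeal k N q + Ideal.span {f} ↔ p ∈ powIdeal k N q ∨
      d ≤ i ∧ ∃ b : MvPolynomial (Fin N) k, b.IsHomogeneous (i - d) ∧
        p - b * f ∈ powIdeal k N q := by
  rw [Submodule.add_eq_sup, sup_comm]
  constructor
  · intro h
    obtain ⟨a, b, hb, rfl⟩ := Ideal.mem_span_singleton_sup.1 h
    have h₁ := homogeneousComponent_mem_powIdeal hb i
    have h₂ := homogeneousComponent_eq_self hp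
    rw [map_add, homogeneousComponent_mul_of_isHomogeneous hf] at h₂
    split_ifs at h₂ with hdi
    · refine Or.inr ⟨hdi, _, homogeneousComponent_isHomogeneous (i - d) a, ?_⟩
      rwa [← h₂, add_sub_cancel_left]
    · rw [zero_add] at h₂
      exact Or.inl (h₂ ▸ h₁)
  · rintro (h | ⟨-, b, -, h⟩)
    · exact Ideal.mem_sup_right h
    · exact Ideal.mem_span_singleton_sup.2 ⟨b, _, h, by ring⟩

lemma finrank_quotient_eq_sum {J : Ideal (MvPolynomial (Fin N) k)} {s : ℕ}
    (hJ : ∀ p ∈ J, ∀ i, homogeneousComponent i p ∈ J)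
    (hs : ∀ i, s < i → ∀ p : MvPolynomial (Fin N) k, p.IsHomogeneous i → p ∈ J) :
    Module.finrank k (MvPolynomial (Fin N) k ⧸ J) =
      ∑ i ∈ Finset.range (s + 1), Module.finrank k (quotComponent J i) := by
  classical
  let φ : (∀ i : Fin (s + 1), quotComponent J i) →ₗ[k] MvPolynomial (Fin N) k ⧸ J :=
    ∑ i : Fin (s + 1), (quotComponent J i).subtype ∘ₗ LinearMap.proj i
  have hφ (v) : φ v = ∑ i, (v i : MvPolynomial (Fin N) k ⧸ J) := by
    simp [φ]
  have inj : Function.Injective φ := by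
    rw [← LinearMap.ker_eq_bot, LinearMap.ker_eq_bot']
    intro v hv
    choose p hp hpv using fun i => (v i).2
    have h₁ : ∑ i, p i ∈ J := by
      rw [← Ideal.Quotient.eq_zero_iff_mem, ← hv, hφ, map_sum]
      exact Finset.sum_congr rfl fun i _ => hpv i
    ext i
    rw [← hpv i]
    refine Ideal.Quotient.eq_zero_iff_mem.2 ?_
    have h₂ := hJ _ h₁ i
    rw [map_sum, Finset.sum_eq_single i, homogeneousComponent_of_mem (hp i), if_pos rfl] at h₂
    · exact h₂
    · intro j _ hji
      rw [homogeneousComponent_of_mem (hp j), if_neg fun h => hji (Fin.ext h.symm)]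
    · exact fun h => absurd (Finset.mem_univ i) h
  have surj : Function.Surjective φ := by
    rw [← LinearMap.range_eq_top, eq_top_iff]
    intro x _
    obtain ⟨p, rfl⟩ := Ideal.Quotient.mk_surjective x
    rw [← sum_homogeneousComponent p, map_sum]
    refine Submodule.sum_mem _ fun i _ => ?_
    by_cases hi : s < i
    · rw [Ideal.Quotient.eq_zero_iff_mem.2 (hs i hi _ (homogeneousComponent_isHomogeneous i p))]
      exact Submodule.zero_mem _
    · refine ⟨Pi.single ⟨i, by omega⟩ ⟨_, Submodule.mem_map_of_mem
        (homogeneousComponent_isHomogeneous i p)⟩, ?_⟩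
      rw [hφ, Finset.sum_eq_single ⟨i, by omega⟩]
      · rw [Pi.single_eq_same]; rfl
      · intro j _ hj
        rw [Pi.single_eq_of_ne hj]; rfl
      · exact fun h => absurd (Finset.mem_univ _) h
  rw [← (LinearEquiv.ofBijective φ ⟨inj, surj⟩).finrank_eq, Module.finrank_pi_fintype,
    Finset.sum_range]

lemma finrank_map_add_finrank_inf_ker {V W : Type*} [AddCommGroup V] [Module k V]
    [AddCommGroup W] [Module k W] (T : Submodule k V) [FiniteDimensional k T] (g : V →ₗ[k] W) :
    Module.finrank k (T.map g) + Module.finrank k (T ⊓ LinearMap.ker g : Submodule k V) =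
      Module.finrank k T := by
  rw [← LinearMap.finrank_range_add_finrank_ker (g.domRestrict T), LinearMap.range_domRestrict,
    LinearMap.ker_domRestrict]
  congr 1
  rw [← Submodule.map_comap_subtype, Submodule.finrank_map_subtype_eq]

lemma ker_mkₐ (J : Ideal (MvPolynomial (Fin N) k)) :
    LinearMap.ker (Ideal.Quotient.mkₐ k J).toLinearMap = J.restrictScalars k := by
  ext p
  exact Ideal.Quotient.eq_zero_iff_mem

lemma finrank_quotComponent_eq_zero_iff {J : Ideal (MvPolynomial (Fin N) k)} {i : ℕ} :
    Module.finrank k (quotComponent J i) = 0 ↔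
      ∀ p : MvPolynomial (Fin N) k, p.IsHomogeneous i → p ∈ J := by
  rw [Submodule.finrank_eq_zero, quotComponent, ← LinearMap.le_ker_iff_map, ker_mkₐ]
  rfl

/-- The rank `r` of multiplication by `f` into the degree-`i` component of `S/I`: it is the drop in
dimension from `S/I` to `S/(I + (f))`, it is at most the dimension of the degree-`(i - d)`
component, and equality holds when the multiplication is injective. -/
lemma finrank_quotComponent_sup {q d i : ℕ} {f : MvPolynomial (Fin N) k}
    (hf : f.IsHomogeneous d) :
    ∃ r, Module.finrank k (quotComponent (powIdeal k N q + Ideal.span {f}) i) + r =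
        boxCount q N i ∧ r ≤ boxCount q N (i - d) ∧
      ((∀ g : MvPolynomial (Fin N) k, d ≤ i → g.IsHomogeneous (i - d) →
        g * f ∈ powIdeal k N q → g ∈ powIdeal k N q) → r = boxCount q N (i - d)) := by
  set I := powIdeal k N q
  set J := I + Ideal.span {f}
  have hIJ : I ≤ J := le_sup_left
  let S (i : ℕ) := homogeneousSubmodule (Fin N) k i
  have e₁ := finrank_map_add_finrank_inf_ker (S i) (Ideal.Quotient.mkₐ k J).toLinearMap
  have e₂ := finrank_map_add_finrank_inf_ker (S i) (Ideal.Quotient.mkₐ k I).toLinearMap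
  have : FiniteDimensional k (S i ⊓ J.restrictScalars k : Submodule k _) :=
    Submodule.finiteDimensional_inf_left _ _
  have e₃ := finrank_map_add_finrank_inf_ker (S i ⊓ J.restrictScalars k)
    (Ideal.Quotient.mkₐ k I).toLinearMap
  have e₄ : S i ⊓ J.restrictScalars k ⊓ I.restrictScalars k = S i ⊓ I.restrictScalars k := by
    rw [inf_assoc, inf_eq_right.2 (show I.restrictScalars k ≤ J.restrictScalars k from hIJ)]
  have e₅ : Module.finrank k ((S i).map (Ideal.Quotient.mkₐ k I).toLinearMap) =
      boxCount q N i := finrank_quotComponent_powIdeal q i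
  rw [ker_mkₐ] at e₁ e₂ e₃
  rw [e₄] at e₃
  rw [e₅] at e₂
  refine ⟨Module.finrank k ((S i ⊓ J.restrictScalars k).map
    (Ideal.Quotient.mkₐ k I).toLinearMap), ?_, ?_⟩
  · have : Module.finrank k (quotComponent J i) =
      Module.finrank k ((S i).map (Ideal.Quotient.mkₐ k J).toLinearMap) := rfl
    omega
  by_cases hdi : d ≤ i
  · have e₆ : Module.finrank k ((S (i - d)).map (Ideal.Quotient.mkₐ k I).toLinearMap) =
      boxCount q N (i - d) := by
      rw [← Nat.cast_sub hdi]
      exact finrank_quotComponent_powIdeal q (i - d)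
    have e₇ := finrank_map_add_finrank_inf_ker (S (i - d)) (Ideal.Quotient.mkₐ k I).toLinearMap
    let μ := (Ideal.Quotient.mkₐ k I).toLinearMap ∘ₗ LinearMap.mulRight k f
    have e₈ := finrank_map_add_finrank_inf_ker (S (i - d)) μ
    have e₉ : (S (i - d)).map μ =
        (S i ⊓ J.restrictScalars k).map (Ideal.Quotient.mkₐ k I).toLinearMap := by
      apply le_antisymm
      · rintro _ ⟨b, hb, rfl⟩
        refine ⟨b * f, ⟨?_, ?_⟩, rfl⟩
        · have := IsHomogeneous.mul hb hf
          rwa [Nat.sub_add_cancel hdi] at this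
        · exact Ideal.mem_sup_right (Ideal.mul_mem_left _ _ (Ideal.mem_span_singleton_self f))
      · rintro _ ⟨p, ⟨hp, hpJ⟩, rfl⟩
        rcases (isHomogeneous_mem_powIdeal_sup_iff hf hp).1 hpJ with h | ⟨-, b, hb, h⟩
        · convert Submodule.zero_mem _
          exact Ideal.Quotient.eq_zero_iff_mem.2 h
        · exact ⟨b, hb, (Ideal.Quotient.eq.2 h).symm⟩
    rw [e₆, ker_mkₐ] at e₇
    rw [e₉] at e₈
    have le : S (i - d) ⊓ I.restrictScalars k ≤ S (i - d) ⊓ LinearMap.ker μ := by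
      refine inf_le_inf_left _ fun p hp => ?_
      exact Ideal.Quotient.eq_zero_iff_mem.2 (Ideal.mul_mem_right f I hp)
    have : FiniteDimensional k (S (i - d) ⊓ LinearMap.ker μ : Submodule k _) :=
      Submodule.finiteDimensional_inf_left _ _
    constructor
    · have := Submodule.finrank_mono le
      omega
    · intro h
      have : S (i - d) ⊓ I.restrictScalars k = S (i - d) ⊓ LinearMap.ker μ :=
        le_antisymm le fun p hp => ⟨hp.1, h p hdi hp.1 (Ideal.Quotient.eq_zero_iff_mem.1 hp.2)⟩
      rw [this] at e₇
      omega
  · have : (S i ⊓ J.restrictScalars k).map (Ideal.Quotient.mkₐ k I).toLinearMap = ⊥ := by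
      rw [← LinearMap.le_ker_iff_map, ker_mkₐ]
      rintro p ⟨hp, hpJ⟩
      rcases (isHomogeneous_mem_powIdeal_sup_iff hf hp).1 hpJ with h | ⟨h, -⟩
      · exact h
      · exact absurd h hdi
    rw [this, boxCount_of_neg q N (by omega)]
    simp

/-- Socle pairing: if `S/(I + (f))` vanishes in degree `N(q-1) - j`, then multiplication by `f`
is injective on the degree-`j` component of `S/I`. -/
lemma mem_powIdeal_of_mul_mem {q j : ℕ} (hq : 1 ≤ q) {f g : MvPolynomial (Fin N) k}
    (hg : g.IsHomogeneous j) (hgf : g * f ∈ powIdeal k N q)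
    (h : ∀ u : MvPolynomial (Fin N) k, u.IsHomogeneous (N * (q - 1) - j) →
      u ∈ powIdeal k N q + Ideal.span {f}) : g ∈ powIdeal k N q := by
  rw [mem_powIdeal]
  intro e he
  by_contra! hlt
  have hdeg : e.degree = j := by
    by_contra hne
    exact mem_support_iff.1 he (hg.coeff_eq_zero hne)
  let e' : Fin N →₀ ℕ := Finsupp.equivFunOnFinite.symm fun i => q - 1 - e i
  have he' (i) : e' i = q - 1 - e i := rfl
  have hsum : e.degree + e'.degree = N * (q - 1) := by
    rw [Finsupp.degree_eq_sum, Finsupp.degree_eq_sum, ← Finset.sum_add_distrib]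
    rw [Finset.sum_congr rfl fun i _ => show e i + e' i = q - 1 by
      have := hlt i; rw [he']; omega]
    simp
  have hu := h (monomial e' 1) (isHomogeneous_monomial 1 (by omega))
  rw [Submodule.add_eq_sup, sup_comm] at hu
  obtain ⟨a, b, hb, hab⟩ := Ideal.mem_span_singleton_sup.1 hu
  have hmem : g * monomial e' 1 ∈ powIdeal k N q := by
    rw [← hab, mul_add, mul_left_comm]
    exact Ideal.add_mem _ (Ideal.mul_mem_left _ _ hgf) (Ideal.mul_mem_left _ _ hb)
  obtain ⟨i, hi⟩ := mem_powIdeal.1 hmem (e + e') (by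
    rw [mem_support_iff, coeff_mul_monomial, mul_one]
    exact mem_support_iff.1 he)
  rw [Finsupp.add_apply, he'] at hi
  have := hlt i
  omega

end

lemma finsum_boxCount_diff (q N : ℕ) (hq : 1 ≤ q) (d : ℤ) :
    ∑ᶠ i : ℤ, max ((boxCount q N i : ℤ) - boxCount q N (i - d)) 0 =
      ∑ i ∈ Finset.range (N * (q - 1) + 1),
        max ((boxCount q N i : ℤ) - boxCount q N (i - d)) 0 := by
  rw [finsum_eq_sum_of_support_subset (s := (Finset.range (N * (q - 1) + 1)).map Nat.castEmbedding),
    Finset.sum_map]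
  · rfl
  · intro i hi
    have h0 : boxCount q N i ≠ 0 := by
      intro h
      apply hi
      simp [h]
    have h₁ : 0 ≤ i := by
      by_contra h
      exact h0 (boxCount_of_neg q N (by omega))
    have h₂ : i ≤ N * (q - 1) := by
      by_contra h
      rw [← boxCount_symm] at h0
      exact h0 (boxCount_of_neg q N (by omega))
    have h₃ : ((N * (q - 1) : ℕ) : ℤ) = N * (q - 1) := by push_cast [hq]; rfl
    simp only [Finset.coe_map, Set.mem_image, Finset.mem_coe, Finset.mem_range]
    exact ⟨i.toNat, by omega, Int.toNat_of_nonneg h₁⟩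

/-- **Maximal-rank criterion: the socle degree is minimal iff the Hilbert-Kunz value is
minimal.**  For `S = k[x₀,…,x_n]` with `n ≥ 1`, `q ≥ 1`, `f` homogeneous of degree `d`
with `0 < d ≤ (n+1)(q−1)`, `I = (x₀^q,…,x_n^q)`, `c_i` the dimension of the degree-`i`
component of `S/I`, `m(q) = ⌊((n+1)(q−1)+d−1)/2⌋` and `L(q) = Σ_i max{c_i − c_{i−d}, 0}`:
the socle degree of `S/(I+(f))` equals `m(q)` iff `dim_k S/(I+(f)) = L(q)`. -/
theorem socle_degree_minimal_iff_hilbert_kunz_minimal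
    (k : Type*) [Field k] (n : ℕ) (hn : 1 ≤ n) (q : ℕ) (hq : 1 ≤ q) (d : ℕ)
    (hd : 0 < d) (hd' : d ≤ (n + 1) * (q - 1))
    (f : MvPolynomial (Fin (n + 1)) k) (hf : f.IsHomogeneous d)
    (I : Ideal (MvPolynomial (Fin (n + 1)) k))
    (hI : I = Ideal.span (Set.range fun i : Fin (n + 1) => X i ^ q)) :
    IsGreatest {i : ℕ | ∃ g : MvPolynomial (Fin (n + 1)) k,
        g.IsHomogeneous i ∧ g ∉ I + Ideal.span {f}}
      (((n + 1) * (q - 1) + d - 1) / 2) ↔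
    (Module.finrank k (MvPolynomial (Fin (n + 1)) k ⧸ (I + Ideal.span {f})) : ℤ) =
      ∑ᶠ i : ℤ, max ((quotComponentDim k (n + 1) I i : ℤ) -
        (quotComponentDim k (n + 1) I (i - d) : ℤ)) 0 := by
  change I = powIdeal k (n + 1) q at hI
  subst hI
  simp only [quotComponentDim_powIdeal]
  have hN : 2 ≤ n + 1 := by omega
  generalize n + 1 = N at *
  have hq2 : 2 ≤ q := by
    by_contra h
    rw [show q - 1 = 0 by omega] at hd'
    omega
  have hcast : ((N * (q - 1) : ℕ) : ℤ) = N * (q - 1) := by push_cast [hq]; rfl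
  rw [finsum_boxCount_diff q N hq,
    finrank_quotient_eq_sum (s := N * (q - 1))
      (fun p hp i => homogeneousComponent_mem_powIdeal_sup hf hp i)
      (fun i hi p hp => Ideal.mem_sup_left (isHomogeneous_mem_powIdeal hi hp))]
  have hC (i : ℤ) := boxCount_symm q N i
  have hle {a b : ℤ} := @boxCount_le q N a b
  have hlt {a b : ℤ} := @boxCount_lt q hq2 N hN a b
  rw [← hcast] at hC
  simp only [← hcast] at hle hlt
  have hpair {j : ℕ} {g : MvPolynomial (Fin N) k} := @mem_powIdeal_of_mul_mem k _ N q j hq f g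
  have hbig {i : ℕ} := @isHomogeneous_mem_powIdeal k _ N q i
  choose r hr₁ hr₂ hr₃ using fun i => finrank_quotComponent_sup (q := q) (i := i) hf
  have hbot {i : ℕ} := @finrank_quotComponent_eq_zero_iff k _ N (powIdeal k N q + Ideal.span {f}) i
  generalize N * (q - 1) = s at *
  push_cast
  have hmax (i : ℕ) :
      max ((boxCount q N i : ℤ) - boxCount q N ((i : ℤ) - d)) 0 ≤
        Module.finrank k (quotComponent (powIdeal k N q + Ideal.span {f}) i) := by
    have := hr₁ i
    have := hr₂ i
    omega
  constructor
  · intro h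
    have hvan (i : ℕ) (hi : s + d ≤ 2 * i) (p : MvPolynomial (Fin N) k) (hp : p.IsHomogeneous i) :
        p ∈ powIdeal k N q + Ideal.span {f} := by
      by_contra hpJ
      have := h.2 ⟨p, hp, hpJ⟩
      omega
    refine Finset.sum_congr rfl fun i _ => ?_
    by_cases hi : s + d ≤ 2 * i
    · have := hbot.2 (hvan i hi)
      have := hr₁ i
      have := hr₂ i
      omega
    · have := hr₃ i fun g hdi hg hgf => hpair hg hgf fun u hu => hvan _ (by omega) u hu
      have := hr₁ i
      omega
  · intro h
    have heq := (Finset.sum_eq_sum_iff_of_le fun i _ => hmax i).1 h.symm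
    constructor
    · by_contra hno
      simp only [Set.mem_ofPred_eq, not_exists, not_and, not_not] at hno
      have h₀ := hbot.2 hno
      have h₁ := heq ((s + d - 1) / 2) (Finset.mem_range.2 (by omega))
      have := @hlt (((s + d - 1) / 2 : ℕ) - d) ((s + d - 1) / 2 : ℕ)
        (by omega) (by omega) (by omega) (by omega)
      omega
    · rintro i ⟨g, hg, hgJ⟩
      by_contra! hi
      by_cases his : s < i
      · exact hgJ (Ideal.mem_sup_left (hbig his hg))
      · refine hgJ (hbot.1 ?_ g hg)
        have h₁ := heq i (Finset.mem_range.2 (by omega))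
        have h₂ := hC i
        have := @hle (s - i) (i - d) (by omega) (by omega)
        omega
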